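/- Suppose K(x) = ∫_{−∞}^x k(y)dy, where k is an integrable real function with ∫ k(y)dy = 1 and ∫ |y k(y)| dy < ∞. Then ∫ K(x){1 − K(x)} dx = (2π)^{-1} ∫ t^{-2} {1 − |φ_k(t)|²} dt. -/

import Mathlib

open MeasureTheory Real Set

/-- The Fourier transform `φ_g(t) = ∫ e^{itx} g(x) dx` of a real function. -/
noncomputable def fourierTr (g : ℝ → ℝ) (t : ℝ) : ℂ :=
  ∫ x : ℝ, Complex.exp (Complex.I * t * x) * (g x : ℂ)

/-- Fubini for a nonnegative kernel `Φ` against a weight `w` of arbitrary sign. -/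
theorem integral_integral_mul_of_kernel_nonneg {α β : Type*} [MeasurableSpace α]
    [MeasurableSpace β] {μ : Measure α} {ν : Measure β} [SFinite μ] [SFinite ν]
    {Φ : α → β → ℝ} {w A : α → ℝ} (hΦm : Measurable (Function.uncurry Φ))
    (hΦ : ∀ p x, 0 ≤ Φ p x) (hw : AEStronglyMeasurable w μ)
    (hi : ∀ᵐ p ∂μ, Integrable (Φ p) ν) (hA : ∀ᵐ p ∂μ, ∫ x, Φ p x ∂ν = A p)
    (hAw : Integrable (fun p => A p * w p) μ) :
    ∫ x, ∫ p, Φ p x * w p ∂μ ∂ν = ∫ p, A p * w p ∂μ := by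
  have hint : Integrable (Function.uncurry fun p x => Φ p x * w p) (μ.prod ν) := by
    have hm : AEStronglyMeasurable (Function.uncurry fun p x => Φ p x * w p) (μ.prod ν) :=
      hΦm.aestronglyMeasurable.mul hw.comp_fst
    refine (integrable_prod_iff hm).2 ⟨hi.mono fun p hp => hp.mul_const (w p), hAw.norm.congr ?_⟩
    filter_upwards [hA] with p hp
    have hAp : 0 ≤ A p := hp ▸ integral_nonneg (hΦ p)
    simp only [Function.uncurry_apply_pair, norm_mul, Real.norm_of_nonneg (hΦ p _),
      integral_mul_const, hp, Real.norm_of_nonneg hAp]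
  rw [← integral_integral_swap hint]
  refine integral_congr_ae ?_
  filter_upwards [hA] with p hp
  simp only [integral_mul_const, hp]

theorem hasDerivAt_exp_mul_one_sub_cos_primitive {s : ℝ} (hs : 0 < s) (t : ℝ) :
    HasDerivAt (fun t => exp (-(s * t)) * ((s * cos t - sin t) / (s ^ 2 + 1) - 1 / s))
      (exp (-(s * t)) * (1 - cos t)) t := by
  have h1 : HasDerivAt (fun t => exp (-(s * t))) (exp (-(s * t)) * -(s * 1)) t :=
    (((hasDerivAt_id t).const_mul s).neg).exp
  have h2 : HasDerivAt (fun t => (s * cos t - sin t) / (s ^ 2 + 1) - 1 / s)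
      ((s * -sin t - cos t) / (s ^ 2 + 1)) t :=
    ((((hasDerivAt_cos t).const_mul s).sub (hasDerivAt_sin t)).div_const _).sub_const _
  refine (h1.mul h2).congr_deriv ?_
  have : s ^ 2 + 1 ≠ 0 := by positivity
  field_simp
  ring

theorem tendsto_exp_mul_one_sub_cos_primitive {s : ℝ} (hs : 0 < s) :
    Filter.Tendsto (fun t => exp (-(s * t)) * ((s * cos t - sin t) / (s ^ 2 + 1) - 1 / s))
      Filter.atTop (nhds 0) := by
  have h0 : Filter.Tendsto (fun t => exp (-(s * t))) Filter.atTop (nhds 0) :=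
    tendsto_exp_neg_atTop_nhds_zero.comp (Filter.tendsto_id.const_mul_atTop hs)
  refine h0.zero_mul_isBoundedUnder_le
    (Filter.isBoundedUnder_of ⟨(s + 1) / (s ^ 2 + 1) + 1 / s, fun t => ?_⟩)
  have hnum : |s * cos t - sin t| ≤ s + 1 := by
    calc |s * cos t - sin t| ≤ |s * cos t| + |sin t| := abs_sub _ _
      _ ≤ s * 1 + 1 := by
        rw [abs_mul, abs_of_pos hs]
        gcongr
        exacts [abs_cos_le_one t, abs_sin_le_one t]
      _ = s + 1 := by ring
  calc |(s * cos t - sin t) / (s ^ 2 + 1) - 1 / s|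
      ≤ |(s * cos t - sin t) / (s ^ 2 + 1)| + |1 / s| := abs_sub _ _
    _ ≤ (s + 1) / (s ^ 2 + 1) + 1 / s := by
      rw [abs_div, abs_of_pos (by positivity : 0 < s ^ 2 + 1),
        abs_of_pos (by positivity : 0 < 1 / s)]
      gcongr

theorem integrableOn_exp_mul_one_sub_cos {s : ℝ} (hs : 0 < s) :
    IntegrableOn (fun t => exp (-(s * t)) * (1 - cos t)) (Ioi 0) :=
  integrableOn_Ioi_deriv_of_nonneg' (fun t _ => hasDerivAt_exp_mul_one_sub_cos_primitive hs t)
    (fun t _ => mul_nonneg (exp_pos _).le (sub_nonneg.2 (cos_le_one t)))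
    (tendsto_exp_mul_one_sub_cos_primitive hs)

theorem integral_Ioi_exp_mul_one_sub_cos {s : ℝ} (hs : 0 < s) :
    ∫ t in Ioi 0, exp (-(s * t)) * (1 - cos t) = (s * (1 + s ^ 2))⁻¹ := by
  rw [integral_Ioi_of_hasDerivAt_of_nonneg'
    (fun t _ => hasDerivAt_exp_mul_one_sub_cos_primitive hs t)
    (fun t _ => mul_nonneg (exp_pos _).le (sub_nonneg.2 (cos_le_one t)))
    (tendsto_exp_mul_one_sub_cos_primitive hs)]
  have : s ^ 2 + 1 ≠ 0 := by positivity
  have : 1 + s ^ 2 ≠ 0 := by positivity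
  simp
  field_simp
  ring

theorem integral_Ioi_mul_exp_neg_mul {t : ℝ} (ht : 0 < t) :
    ∫ s in Ioi 0, s * exp (-(s * t)) = (t ^ 2)⁻¹ := by
  have h := Real.integral_rpow_mul_exp_neg_mul_Ioi (a := 2) two_pos ht
  norm_num [Real.Gamma_two] at h
  simpa only [mul_comm t] using h

theorem integral_Ioi_inv_sq_mul_one_sub_cos :
    ∫ t in Ioi (0 : ℝ), (t ^ 2)⁻¹ * (1 - cos t) = π / 2 := by
  have hA : ∀ s ∈ Ioi (0 : ℝ), (s * (1 + s ^ 2))⁻¹ * s = (1 + s ^ 2)⁻¹ := by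
    intro s hs
    have : s ≠ 0 := (mem_Ioi.1 hs).ne'
    field_simp
  have key := integral_integral_mul_of_kernel_nonneg
    (μ := volume.restrict (Ioi (0 : ℝ))) (ν := volume.restrict (Ioi (0 : ℝ)))
    (Φ := fun s t => exp (-(s * t)) * (1 - cos t)) (w := fun s => s)
    (A := fun s => (s * (1 + s ^ 2))⁻¹)
    (by unfold Function.uncurry; fun_prop)
    (fun s t => mul_nonneg (exp_pos _).le (sub_nonneg.2 (cos_le_one t)))
    (by fun_prop)
    ((ae_restrict_mem measurableSet_Ioi).mono fun s hs => integrableOn_exp_mul_one_sub_cos hs)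
    ((ae_restrict_mem measurableSet_Ioi).mono fun s hs => integral_Ioi_exp_mul_one_sub_cos hs)
    (integrable_inv_one_add_sq.integrableOn.congr_fun (fun s hs => (hA s hs).symm)
      measurableSet_Ioi)
  rw [setIntegral_congr_fun measurableSet_Ioi hA, integral_Ioi_inv_one_add_sq, arctan_zero,
    sub_zero] at key
  rw [← key]
  refine setIntegral_congr_fun measurableSet_Ioi fun t ht => ?_
  rw [← integral_Ioi_mul_exp_neg_mul ht, ← integral_mul_const]
  congr 1 with s
  ring

theorem integral_inv_sq_mul_one_sub_cos_mul (u : ℝ) :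
    ∫ t : ℝ, (t ^ 2)⁻¹ * (1 - cos (t * u)) = π * |u| := by
  rcases eq_or_ne u 0 with rfl | hu
  · simp
  have hone : ∫ t : ℝ, (t ^ 2)⁻¹ * (1 - cos t) = π := by
    have h := integral_comp_abs (f := fun t : ℝ => (t ^ 2)⁻¹ * (1 - cos t))
    simp only [sq_abs, cos_abs] at h
    rw [h, integral_Ioi_inv_sq_mul_one_sub_cos]
    ring
  have hscale := Measure.integral_comp_mul_right (fun t : ℝ => (t ^ 2)⁻¹ * (1 - cos t)) u
  calc ∫ t : ℝ, (t ^ 2)⁻¹ * (1 - cos (t * u))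
      = ∫ t : ℝ, u ^ 2 * (((t * u) ^ 2)⁻¹ * (1 - cos (t * u))) := by
        congr 1 with t
        rw [mul_pow, mul_inv]
        field_simp
    _ = π * |u| := by
        rw [integral_const_mul, hscale, hone, smul_eq_mul, abs_inv, ← sq_abs u]
        have : |u| ≠ 0 := abs_ne_zero.2 hu
        field_simp

theorem integrable_inv_sq_mul_one_sub_cos_mul (u : ℝ) :
    Integrable fun t : ℝ => (t ^ 2)⁻¹ * (1 - cos (t * u)) := by
  rcases eq_or_ne u 0 with rfl | hu
  · simp
  refine Integrable.of_integral_ne_zero ?_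
  rw [integral_inv_sq_mul_one_sub_cos_mul]
  exact mul_ne_zero pi_ne_zero (abs_ne_zero.2 hu)

theorem integrable_sub_mul_mul {k : ℝ → ℝ} (hk : Integrable k)
    (hkmom : Integrable fun y => y * k y) :
    Integrable (fun p : ℝ × ℝ => (p.2 - p.1) * (k p.1 * k p.2)) := by
  refine ((hk.mul_prod hkmom).sub (hkmom.mul_prod hk)).congr (ae_of_all _ fun p => ?_)
  simp only [Pi.sub_apply]
  ring

theorem integrable_abs_sub_mul_mul {k : ℝ → ℝ} (hk : Integrable k)
    (hkmom : Integrable fun y => y * k y) :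
    Integrable (fun p : ℝ × ℝ => |p.2 - p.1| * (k p.1 * k p.2)) := by
  refine (integrable_sub_mul_mul hk hkmom).mono
    ((by fun_prop : Continuous fun p : ℝ × ℝ => |p.2 - p.1|).aestronglyMeasurable.mul
      (hk.mul_prod hk).aestronglyMeasurable) (ae_of_all _ fun p => ?_)
  simp

/-- The positive part `(z - y)⁺` may be symmetrised to `|z - y| / 2`. -/
theorem integral_max_sub_mul_mul {k : ℝ → ℝ} (hk : Integrable k)
    (hkmom : Integrable fun y => y * k y) :
    ∫ p : ℝ × ℝ, max (p.2 - p.1) 0 * (k p.1 * k p.2) =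
      2⁻¹ * ∫ p : ℝ × ℝ, |p.2 - p.1| * (k p.1 * k p.2) := by
  have hanti : ∫ p : ℝ × ℝ, (p.2 - p.1) * (k p.1 * k p.2) = 0 := by
    have h := integral_prod_swap (μ := volume) (ν := volume)
      (fun p : ℝ × ℝ => (p.2 - p.1) * (k p.1 * k p.2))
    have hneg : ∀ p : ℝ × ℝ, (p.swap.2 - p.swap.1) * (k p.swap.1 * k p.swap.2) =
        -((p.2 - p.1) * (k p.1 * k p.2)) := fun p => by
      simp only [Prod.fst_swap, Prod.snd_swap]
      ring
    simp only [hneg, integral_neg] at h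
    rw [Measure.volume_eq_prod]
    linarith
  calc ∫ p : ℝ × ℝ, max (p.2 - p.1) 0 * (k p.1 * k p.2)
      = ∫ p : ℝ × ℝ, 2⁻¹ * ((p.2 - p.1) * (k p.1 * k p.2) +
          |p.2 - p.1| * (k p.1 * k p.2)) := by
        congr 1 with p
        rcases le_total 0 (p.2 - p.1) with h | h
        · rw [max_eq_left h, abs_of_nonneg h]
          ring
        · rw [max_eq_right h, abs_of_nonpos h]
          ring
    _ = _ := by
        rw [integral_const_mul, integral_add (integrable_sub_mul_mul hk hkmom)
          (integrable_abs_sub_mul_mul hk hkmom), hanti, zero_add]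

theorem integral_setIntegral_Iic_mul_Ioi {k : ℝ → ℝ} (hk : Integrable k)
    (hkmom : Integrable fun y => y * k y) :
    ∫ x, (∫ y in Iic x, k y) * (∫ z in Ioi x, k z) =
      ∫ p : ℝ × ℝ, max (p.2 - p.1) 0 * (k p.1 * k p.2) := by
  have hmax : Integrable (fun p : ℝ × ℝ => max (p.2 - p.1) 0 * (k p.1 * k p.2)) := by
    refine (integrable_sub_mul_mul hk hkmom).mono
      ((by fun_prop : Continuous fun p : ℝ × ℝ => max (p.2 - p.1) 0).aestronglyMeasurable.mul
        (hk.mul_prod hk).aestronglyMeasurable) (ae_of_all _ fun p => ?_)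
    rw [norm_mul, norm_mul (p.2 - p.1)]
    gcongr
    rw [norm_of_nonneg (le_max_right _ _)]
    exact max_le (le_abs_self _) (abs_nonneg _)
  rw [← integral_integral_mul_of_kernel_nonneg (μ := volume) (ν := volume)
    (w := fun p : ℝ × ℝ => k p.1 * k p.2)
    (Φ := fun (p : ℝ × ℝ) x => (Ico p.1 p.2).indicator (fun _ => (1 : ℝ)) x) ?_
    (fun p x => indicator_nonneg (fun _ _ => zero_le_one) x)
    (hk.mul_prod hk).aestronglyMeasurable
    (ae_of_all _ fun p => ?_) (ae_of_all _ fun p => ?_) hmax]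
  · congr 1 with x
    rw [← integral_indicator measurableSet_Iic, ← integral_indicator measurableSet_Ioi,
      ← integral_prod_mul, Measure.volume_eq_prod]
    congr 1 with p
    by_cases h1 : p.1 ≤ x <;> by_cases h2 : x < p.2 <;> simp [indicator, h1, h2]
  · have hs : MeasurableSet {q : (ℝ × ℝ) × ℝ | q.1.1 ≤ q.2 ∧ q.2 < q.1.2} := by measurability
    exact measurable_const.indicator hs
  · exact (integrable_indicator_iff measurableSet_Ico).2
      (integrableOn_const (by simp) (by simp))
  · rw [integral_indicator measurableSet_Ico]
    simp [Measure.real, ENNReal.toReal_ofReal']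

theorem norm_fourierTr_sq {k : ℝ → ℝ} (hk : Integrable k) (t : ℝ) :
    ‖fourierTr k t‖ ^ 2 = ∫ p : ℝ × ℝ, cos (t * (p.2 - p.1)) * (k p.1 * k p.2) := by
  have hc : Integrable fun x => cos (t * x) * k x :=
    hk.bdd_mul (c := 1) (by fun_prop) (ae_of_all _ fun x => abs_cos_le_one _)
  have hs : Integrable fun x => sin (t * x) * k x :=
    hk.bdd_mul (c := 1) (by fun_prop) (ae_of_all _ fun x => abs_sin_le_one _)
  have hφ : fourierTr k t =
      ((∫ x, cos (t * x) * k x : ℝ) : ℂ) + ((∫ x, sin (t * x) * k x : ℝ) : ℂ) * Complex.I := by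
    rw [← integral_complex_ofReal, ← integral_complex_ofReal, ← integral_mul_const,
      ← integral_add hc.ofReal (hs.ofReal.mul_const _)]
    refine integral_congr_ae (ae_of_all _ fun x => ?_)
    have : Complex.I * t * x = ((t * x : ℝ) : ℂ) * Complex.I := by push_cast; ring
    simp only [this, Complex.exp_mul_I, ← Complex.ofReal_cos, ← Complex.ofReal_sin]
    push_cast
    ring
  rw [hφ, Complex.sq_norm, Complex.normSq_add_mul_I, sq, sq, ← integral_prod_mul,
    ← integral_prod_mul, ← integral_add (hc.mul_prod hc) (hs.mul_prod hs),
    Measure.volume_eq_prod]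
  congr 1 with p
  rw [mul_sub, cos_sub]
  ring

theorem integral_inv_sq_mul_one_sub_norm_fourierTr_sq {k : ℝ → ℝ} (hk : Integrable k)
    (hk_one : ∫ y, k y = 1) (hkmom : Integrable fun y => y * k y) :
    ∫ t : ℝ, (t ^ 2)⁻¹ * (1 - ‖fourierTr k t‖ ^ 2) =
      π * ∫ p : ℝ × ℝ, |p.2 - p.1| * (k p.1 * k p.2) := by
  have hkk : Integrable (fun p : ℝ × ℝ => k p.1 * k p.2) := hk.mul_prod hk
  have hkk_one : ∫ p : ℝ × ℝ, k p.1 * k p.2 = 1 := by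
    rw [Measure.volume_eq_prod, integral_prod_mul, hk_one, one_mul]
  have hAw : Integrable (fun p : ℝ × ℝ => π * |p.2 - p.1| * (k p.1 * k p.2)) := by
    simpa only [mul_assoc] using (integrable_abs_sub_mul_mul hk hkmom).const_mul π
  have key := integral_integral_mul_of_kernel_nonneg (ν := volume)
    (Φ := fun (p : ℝ × ℝ) t => (t ^ 2)⁻¹ * (1 - cos (t * (p.2 - p.1))))
    (by unfold Function.uncurry; fun_prop)
    (fun p t => mul_nonneg (by positivity) (sub_nonneg.2 (cos_le_one _)))
    hkk.aestronglyMeasurable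
    (ae_of_all _ fun p => integrable_inv_sq_mul_one_sub_cos_mul _)
    (ae_of_all _ fun p => integral_inv_sq_mul_one_sub_cos_mul _) hAw
  simp only [mul_assoc, integral_const_mul] at key
  rw [← key]
  congr 1 with t
  have hcos : Integrable (fun p : ℝ × ℝ => cos (t * (p.2 - p.1)) * (k p.1 * k p.2)) :=
    hkk.bdd_mul (c := 1) (by fun_prop) (ae_of_all _ fun p => abs_cos_le_one _)
  rw [norm_fourierTr_sq hk]
  simp only [sub_mul, one_mul]
  rw [integral_sub hkk hcos, hkk_one]

/-- **Lemma 1.** If `K(x) = ∫_{-∞}^x k(y) dy` with `k` integrable, `∫ k = 1` and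
`∫ |y k(y)| dy < ∞`, then `∫ K(1-K) = (2π)⁻¹ ∫ t⁻² (1 - |φ_k(t)|²) dt`. -/
theorem psiK_fourier_formula
    (k : ℝ → ℝ) (hk_int : Integrable k) (hk_one : ∫ y, k y = 1)
    (hkmom : Integrable (fun y => y * k y))
    (K : ℝ → ℝ) (hK : ∀ x, K x = ∫ y in Iic x, k y) :
    ∫ x : ℝ, K x * (1 - K x) =
      (2 * π)⁻¹ * ∫ t : ℝ, (t ^ 2)⁻¹ * (1 - ‖fourierTr k t‖ ^ 2) := by
  have hcompl : ∀ x, 1 - K x = ∫ z in Ioi x, k z := fun x => by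
    rw [hK, ← hk_one, ← intervalIntegral.integral_Iic_add_Ioi hk_int.integrableOn
      hk_int.integrableOn (b := x), add_sub_cancel_left]
  simp only [hcompl]
  simp only [hK]
  rw [integral_setIntegral_Iic_mul_Ioi hk_int hkmom, integral_max_sub_mul_mul hk_int hkmom,
    integral_inv_sq_mul_one_sub_norm_fourierTr_sq hk_int hk_one hkmom]
  field_simp
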